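/- arXiv:2307.14764 — 2 statements merged into one kernel-verified Lean document; each statement's English description precedes it below -/
import Mathlib

section
/- Let (C, ⊗, 1, c) be a braided monoidal category and (M, ▷, m, λ) a left C-module category. Then the reflective center E_C(M) is a left C-module category with action Y ▷ (M, e^M) := (Y ▷ M, e^{Y▷M}), where for each X ∈ C the component e^{Y▷M}_X is defined by e^{Y▷M}_X := m_{X,Y,M} ∘ (c_{Y,X} ▷ Id_M) ∘ m_{Y,X,M}^{-1} ∘ (Id_Y ▷ e^M_X) ∘ m_{Y,X,M} ∘ (c_{X,Y} ▷ Id_M) ∘ m_{X,Y,M}^{-1}, and with associativity and unit constraints those of M. In particular, (Y ▷ M, e^{Y▷M}) is again an object of E_C(M), the constraints of M are morphisms in E_C(M), and the action is well defined on morphisms. -/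
open CategoryTheory MonoidalCategory

universe v₁ v₂ u₁ u₂

namespace Refl

variable (C : Type u₁) [Category.{v₁} C] [MonoidalCategory C]
variable (M : Type u₂) [Category.{v₂} M]

/-- Data of a left module category over a monoidal category:
an action bifunctor together with associativity and unit constraints. -/
structure LeftModuleData where
  act : C ⥤ M ⥤ M
  assocIso : ∀ (X Y : C) (m : M),
    (act.obj (X ⊗ Y)).obj m ≅ (act.obj X).obj ((act.obj Y).obj m)
  unitIso : ∀ (m : M), (act.obj (𝟙_ C)).obj m ≅ m

namespace LeftModuleData

variable {C M}

/-- The axioms (naturality of the constraints, module pentagon and triangle)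
making `LeftModuleData` into a genuine left module category structure. -/
structure IsModule (S : LeftModuleData C M) : Prop where
  assoc_natural_left : ∀ {X X' : C} (f : X ⟶ X') (Y : C) (m : M),
    (S.act.map (f ▷ Y)).app m ≫ (S.assocIso X' Y m).hom
      = (S.assocIso X Y m).hom ≫ (S.act.map f).app ((S.act.obj Y).obj m)
  assoc_natural_mid : ∀ (X : C) {Y Y' : C} (g : Y ⟶ Y') (m : M),
    (S.act.map (X ◁ g)).app m ≫ (S.assocIso X Y' m).hom
      = (S.assocIso X Y m).hom ≫ (S.act.obj X).map ((S.act.map g).app m)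
  assoc_natural_right : ∀ (X Y : C) {m m' : M} (h : m ⟶ m'),
    (S.act.obj (X ⊗ Y)).map h ≫ (S.assocIso X Y m').hom
      = (S.assocIso X Y m).hom ≫ (S.act.obj X).map ((S.act.obj Y).map h)
  unit_natural : ∀ {m m' : M} (h : m ⟶ m'),
    (S.act.obj (𝟙_ C)).map h ≫ (S.unitIso m').hom = (S.unitIso m).hom ≫ h
  pentagon : ∀ (X Y Z : C) (m : M),
    (S.assocIso (X ⊗ Y) Z m).hom ≫ (S.assocIso X Y ((S.act.obj Z).obj m)).hom
      = (S.act.map (α_ X Y Z).hom).app m ≫ (S.assocIso X (Y ⊗ Z) m).hom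
          ≫ (S.act.obj X).map ((S.assocIso Y Z m).hom)
  triangle : ∀ (X : C) (m : M),
    (S.act.map (ρ_ X).hom).app m
      = (S.assocIso X (𝟙_ C) m).hom ≫ (S.act.obj X).map ((S.unitIso m).hom)

end LeftModuleData

/-- The regular left module category structure of a monoidal category on itself. -/
def regularData : LeftModuleData C C where
  act := curriedTensor C
  assocIso X Y m := α_ X Y m
  unitIso m := λ_ m

variable {C M}

section Braiding

variable [BraidedCategory C]

/-- A braiding (family of endo-isomorphisms `e_{X,m} : X ▷ m ≅ X ▷ m`) on a left module
category over a braided monoidal category, given as raw data. -/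
abbrev BraidingData (S : LeftModuleData C M) :=
  ∀ (X : C) (m : M), (S.act.obj X).obj m ≅ (S.act.obj X).obj m

/-- The axioms for a braided left module category:
naturality of `e` together with the two braided module category axioms. -/
structure IsModuleBraiding (S : LeftModuleData C M) (e : BraidingData S) : Prop where
  natural : ∀ {X X' : C} (f : X ⟶ X') {m m' : M} (g : m ⟶ m'),
    ((S.act.map f).app m ≫ (S.act.obj X').map g) ≫ (e X' m').hom
      = (e X m).hom ≫ ((S.act.map f).app m ≫ (S.act.obj X').map g)
  braid_tensor : ∀ (X Y : C) (m : M),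
    (e (X ⊗ Y) m).hom
      = (S.act.map (β_ Y X).inv).app m
          ≫ (S.assocIso Y X m).hom
          ≫ (S.act.obj Y).map ((e X m).hom)
          ≫ (S.assocIso Y X m).inv
          ≫ (S.act.map (β_ Y X).hom).app m
          ≫ (S.assocIso X Y m).hom
          ≫ (S.act.obj X).map ((e Y m).hom)
          ≫ (S.assocIso X Y m).inv
  braid_act : ∀ (X Y : C) (m : M),
    (e X ((S.act.obj Y).obj m)).hom
      = (S.assocIso X Y m).inv
          ≫ (S.act.map (β_ X Y).hom).app m
          ≫ (S.assocIso Y X m).hom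
          ≫ (S.act.obj Y).map ((e X m).hom)
          ≫ (S.assocIso Y X m).inv
          ≫ (S.act.map (β_ Y X).hom).app m
          ≫ (S.assocIso X Y m).hom

end Braiding


section ReflectiveCenter

variable [BraidedCategory C]

/-- A reflection on an object `m` of a left module category over a braided category:
a natural family of isomorphisms `e_X : X ▷ m ≅ X ▷ m` satisfying the reflection
axiom (eq. (3.5) of the paper). -/
structure IsReflection (S : LeftModuleData C M) {m : M}
    (e : ∀ X : C, (S.act.obj X).obj m ≅ (S.act.obj X).obj m) : Prop where
  natural : ∀ {X Y : C} (f : X ⟶ Y),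
    (S.act.map f).app m ≫ (e Y).hom = (e X).hom ≫ (S.act.map f).app m
  refl_tensor : ∀ X Y : C,
    (e (X ⊗ Y)).hom
      = (S.act.map (β_ Y X).inv).app m
          ≫ (S.assocIso Y X m).hom
          ≫ (S.act.obj Y).map ((e X).hom)
          ≫ (S.assocIso Y X m).inv
          ≫ (S.act.map (β_ Y X).hom).app m
          ≫ (S.assocIso X Y m).hom
          ≫ (S.act.obj X).map ((e Y).hom)
          ≫ (S.assocIso X Y m).inv

/-- The reflection `e^{Y ▷ m}` induced on `Y ▷ m` by a reflection `e = e^m` on `m`,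
given by formula (3.6):
`e^{Y▷m}_X = m_{X,Y,m} ∘ (c_{Y,X} ▷ Id) ∘ m⁻¹_{Y,X,m} ∘ (Id_Y ▷ e_X) ∘ m_{Y,X,m} ∘ (c_{X,Y} ▷ Id) ∘ m⁻¹_{X,Y,m}`. -/
def inducedRefl (S : LeftModuleData C M) {m : M}
    (e : ∀ X : C, (S.act.obj X).obj m ≅ (S.act.obj X).obj m) (Y : C) :
    ∀ X : C, (S.act.obj X).obj ((S.act.obj Y).obj m)
      ≅ (S.act.obj X).obj ((S.act.obj Y).obj m) :=
  fun X =>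
    (S.assocIso X Y m).symm
      ≪≫ (S.act.mapIso (β_ X Y)).app m
      ≪≫ S.assocIso Y X m
      ≪≫ (S.act.obj Y).mapIso (e X)
      ≪≫ (S.assocIso Y X m).symm
      ≪≫ (S.act.mapIso (β_ Y X)).app m
      ≪≫ S.assocIso X Y m

/-- The condition for `f : m ⟶ n` to be a morphism in the reflective center,
from `(m, e)` to `(n, e')`. -/
def IsReflHom (S : LeftModuleData C M) {m n : M}
    (e : ∀ X : C, (S.act.obj X).obj m ≅ (S.act.obj X).obj m)
    (e' : ∀ X : C, (S.act.obj X).obj n ≅ (S.act.obj X).obj n)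
    (f : m ⟶ n) : Prop :=
  ∀ X : C, (e X).hom ≫ (S.act.obj X).map f = (S.act.obj X).map f ≫ (e' X).hom

end ReflectiveCenter

end Refl

namespace Refl

variable {C : Type u₁} [Category.{v₁} C] [MonoidalCategory C]
variable {M : Type u₂} [Category.{v₂} M]

namespace LeftModuleData

/-- The isomorphism `X ▷ (Y ▷ m) ≅ Y ▷ (X ▷ m)` induced by the braiding `c_{X,Y}`. -/
def swap [BraidedCategory C] (S : LeftModuleData C M) (X Y : C) (m : M) :
    (S.act.obj X).obj ((S.act.obj Y).obj m) ≅ (S.act.obj Y).obj ((S.act.obj X).obj m) :=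
  (S.assocIso X Y m).symm ≪≫ (S.act.mapIso (β_ X Y)).app m ≪≫ S.assocIso Y X m

lemma assocIso_hom_comp_swap [BraidedCategory C] (S : LeftModuleData C M) (X Y : C) (m : M) :
    (S.assocIso X Y m).hom ≫ (S.swap X Y m).hom
      = (S.act.map (β_ X Y).hom).app m ≫ (S.assocIso Y X m).hom := by
  simp [swap]

namespace IsModule

variable {S : LeftModuleData C M}

/-- The left unit triangle follows from the right one and the pentagon. -/
lemma leftUnitor_app (hS : S.IsModule) (X : C) (m : M) :
    (S.act.map (λ_ X).hom).app m
      = (S.assocIso (𝟙_ C) X m).hom ≫ (S.unitIso ((S.act.obj X).obj m)).hom := by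
  have faithful : ∀ {a b : M} {f g : a ⟶ b},
      (S.act.obj (𝟙_ C)).map f = (S.act.obj (𝟙_ C)).map g → f = g := by
    intro a b f g h
    rw [← cancel_epi (S.unitIso a).hom, ← hS.unit_natural, ← hS.unit_natural, h]
  apply faithful
  rw [← cancel_epi (S.assocIso (𝟙_ C) (𝟙_ C ⊗ X) m).hom,
    ← cancel_epi ((S.act.mapIso (α_ (𝟙_ C) (𝟙_ C) X)).app m).hom, ← hS.assoc_natural_mid]
  have hp := hS.pentagon (𝟙_ C) (𝟙_ C) X m =≫
    (S.act.obj (𝟙_ C)).map (S.unitIso ((S.act.obj X).obj m)).hom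
  simp only [Category.assoc] at hp
  have hl := hS.assoc_natural_left (ρ_ (𝟙_ C)).hom X m
  rw [hS.triangle, hp, ← MonoidalCategory.triangle, Functor.map_comp, NatTrans.comp_app,
    Category.assoc] at hl
  rw [Functor.map_comp]
  exact hl

lemma map_assocIso_hom (hS : S.IsModule) (X Y Z : C) (m : M) :
    (S.act.obj X).map (S.assocIso Y Z m).hom
      = (S.assocIso X (Y ⊗ Z) m).inv ≫ (S.act.map (α_ X Y Z).inv).app m
        ≫ (S.assocIso (X ⊗ Y) Z m).hom ≫ (S.assocIso X Y ((S.act.obj Z).obj m)).hom := by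
  rw [hS.pentagon, ← NatTrans.comp_app_assoc, ← Functor.map_comp]
  simp

lemma map_assocIso_inv (hS : S.IsModule) (X Y Z : C) (m : M) :
    (S.act.obj X).map (S.assocIso Y Z m).inv
      = (S.assocIso X Y ((S.act.obj Z).obj m)).inv ≫ (S.assocIso (X ⊗ Y) Z m).inv
        ≫ (S.act.map (α_ X Y Z).hom).app m ≫ (S.assocIso X (Y ⊗ Z) m).hom := by
  rw [← cancel_mono ((S.act.obj X).map (S.assocIso Y Z m).hom), Iso.map_inv_hom_id]
  simp [hS.map_assocIso_hom]

lemma map_app_act (hS : S.IsModule) {X X' : C} (f : X ⟶ X') (Y : C) (m : M) :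
    (S.act.map f).app ((S.act.obj Y).obj m)
      = (S.assocIso X Y m).inv ≫ (S.act.map (f ▷ Y)).app m ≫ (S.assocIso X' Y m).hom := by
  simp [hS.assoc_natural_left]

lemma act_map_map_app (hS : S.IsModule) (X : C) {Y Y' : C} (g : Y ⟶ Y') (m : M) :
    (S.act.obj X).map ((S.act.map g).app m)
      = (S.assocIso X Y m).inv ≫ (S.act.map (X ◁ g)).app m ≫ (S.assocIso X Y' m).hom := by
  simp [hS.assoc_natural_mid]

section

variable [BraidedCategory C]

lemma swap_natural_object (hS : S.IsModule) (X Y : C) {m n : M} (f : m ⟶ n) :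
    (S.swap X Y m).hom ≫ (S.act.obj Y).map ((S.act.obj X).map f)
      = (S.act.obj X).map ((S.act.obj Y).map f) ≫ (S.swap X Y n).hom := by
  simp only [swap, Iso.trans_hom, Iso.symm_hom, Iso.app_hom, Functor.mapIso_hom,
    Category.assoc]
  rw [← hS.assoc_natural_right, Iso.inv_comp_eq, ← NatTrans.naturality_assoc,
    ← Category.assoc (S.assocIso X Y m).hom, ← hS.assoc_natural_right]
  simp

lemma swap_natural_left (hS : S.IsModule) {X X' : C} (f : X ⟶ X') (Y : C) (m : M) :
    (S.swap X Y m).hom ≫ (S.act.obj Y).map ((S.act.map f).app m)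
      = (S.act.map f).app ((S.act.obj Y).obj m) ≫ (S.swap X' Y m).hom := by
  simp only [swap, Iso.trans_hom, Iso.symm_hom, Iso.app_hom, Functor.mapIso_hom,
    Category.assoc]
  rw [← hS.assoc_natural_mid, Iso.inv_comp_eq, ← Category.assoc (S.assocIso X Y m).hom,
    ← hS.assoc_natural_left]
  have h := congrArg (fun t ↦ (S.act.map t).app m) (BraidedCategory.braiding_naturality_left f Y)
  simp only [Functor.map_comp, NatTrans.comp_app] at h
  simpa using h.symm

lemma swap_natural_right (hS : S.IsModule) (X : C) {Y Y' : C} (f : Y ⟶ Y') (m : M) :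
    (S.swap X Y m).hom ≫ (S.act.map f).app ((S.act.obj X).obj m)
      = (S.act.obj X).map ((S.act.map f).app m) ≫ (S.swap X Y' m).hom := by
  simp only [swap, Iso.trans_hom, Iso.symm_hom, Iso.app_hom, Functor.mapIso_hom,
    Category.assoc]
  rw [← hS.assoc_natural_left, Iso.inv_comp_eq, ← Category.assoc (S.assocIso X Y m).hom,
    ← hS.assoc_natural_mid]
  have h := congrArg (fun t ↦ (S.act.map t).app m) (BraidedCategory.braiding_naturality_right X f)
  simp only [Functor.map_comp, NatTrans.comp_app] at h
  simpa using h.symm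

lemma swap_tensor_left (hS : S.IsModule) (X Y Z : C) (m : M) :
    (S.swap (X ⊗ Y) Z m).hom ≫ (S.act.obj Z).map (S.assocIso X Y m).hom
      = (S.assocIso X Y ((S.act.obj Z).obj m)).hom
        ≫ (S.act.obj X).map (S.swap Y Z m).hom ≫ (S.swap X Z ((S.act.obj Y).obj m)).hom := by
  simp [swap, hS.map_assocIso_hom, hS.map_assocIso_inv, hS.map_app_act, hS.act_map_map_app]

lemma swap_tensor_right (hS : S.IsModule) (X Y Z : C) (m : M) :
    (S.swap X (Y ⊗ Z) m).hom ≫ (S.assocIso Y Z ((S.act.obj X).obj m)).hom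
      = (S.act.obj X).map (S.assocIso Y Z m).hom
        ≫ (S.swap X Y ((S.act.obj Z).obj m)).hom ≫ (S.act.obj Y).map (S.swap X Z m).hom := by
  simp [swap, hS.map_assocIso_hom, hS.map_assocIso_inv, hS.map_app_act, hS.act_map_map_app]

lemma swap_yang_baxter (hS : S.IsModule) (X Y Z : C) (m : M) :
    (S.swap X Y ((S.act.obj Z).obj m)).hom ≫ (S.act.obj Y).map (S.swap X Z m).hom
        ≫ (S.swap Y Z ((S.act.obj X).obj m)).hom
      = (S.act.obj X).map (S.swap Y Z m).hom ≫ (S.swap X Z ((S.act.obj Y).obj m)).hom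
        ≫ (S.act.obj Z).map (S.swap X Y m).hom := by
  rw [← cancel_epi (S.assocIso X Y ((S.act.obj Z).obj m)).hom,
    reassoc_of% S.assocIso_hom_comp_swap, ← hS.swap_tensor_left, ← reassoc_of% hS.swap_natural_left,
    ← reassoc_of% hS.swap_tensor_left, ← Functor.map_comp, ← Functor.map_comp,
    assocIso_hom_comp_swap]

lemma swap_unit_right (hS : S.IsModule) (X : C) (m : M) :
    (S.swap X (𝟙_ C) m).hom ≫ (S.unitIso ((S.act.obj X).obj m)).hom
      = (S.act.obj X).map (S.unitIso m).hom := by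
  simp only [swap, Iso.trans_hom, Iso.symm_hom, Iso.app_hom, Functor.mapIso_hom,
    Category.assoc]
  rw [← hS.leftUnitor_app, Iso.inv_comp_eq, ← hS.triangle, ← NatTrans.comp_app,
    ← Functor.map_comp, braiding_leftUnitor]

lemma swap_unit_left (hS : S.IsModule) (X : C) (m : M) :
    (S.swap (𝟙_ C) X m).hom ≫ (S.act.obj X).map (S.unitIso m).hom
      = (S.unitIso ((S.act.obj X).obj m)).hom := by
  simp only [swap, Iso.trans_hom, Iso.symm_hom, Iso.app_hom, Functor.mapIso_hom,
    Category.assoc]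
  rw [← hS.triangle, Iso.inv_comp_eq, ← hS.leftUnitor_app, ← NatTrans.comp_app,
    ← Functor.map_comp, braiding_rightUnitor]

end

end IsModule

end LeftModuleData

section

variable [BraidedCategory C] {S : LeftModuleData C M}

lemma inducedRefl_hom {m : M}
    (e : ∀ X : C, (S.act.obj X).obj m ≅ (S.act.obj X).obj m) (X Y : C) :
    (inducedRefl S e Y X).hom
      = (S.swap X Y m).hom ≫ (S.act.obj Y).map (e X).hom ≫ (S.swap Y X m).hom := by
  simp [inducedRefl, LeftModuleData.swap]

/-- The reflection axiom, stated on the iterated action `X ▷ (Y ▷ m)`. -/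
lemma refl_tensor_iff {m : M}
    (e : ∀ X : C, (S.act.obj X).obj m ≅ (S.act.obj X).obj m) (X Y : C) :
    (e (X ⊗ Y)).hom
      = (S.act.map (β_ Y X).inv).app m
          ≫ (S.assocIso Y X m).hom
          ≫ (S.act.obj Y).map ((e X).hom)
          ≫ (S.assocIso Y X m).inv
          ≫ (S.act.map (β_ Y X).hom).app m
          ≫ (S.assocIso X Y m).hom
          ≫ (S.act.obj X).map ((e Y).hom)
          ≫ (S.assocIso X Y m).inv
      ↔ (S.swap Y X m).hom ≫ (S.assocIso X Y m).inv ≫ (e (X ⊗ Y)).hom ≫ (S.assocIso X Y m).hom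
        = (S.act.obj Y).map (e X).hom ≫ (S.swap Y X m).hom ≫ (S.act.obj X).map (e Y).hom := by
  rw [← cancel_epi (S.act.map (β_ Y X).hom |>.app m), ← cancel_mono (S.assocIso X Y m).hom,
    ← cancel_epi (S.assocIso Y X m).inv]
  simp [LeftModuleData.swap]

lemma isReflection_inducedRefl (hS : S.IsModule) {m : M}
    {e : ∀ X : C, (S.act.obj X).obj m ≅ (S.act.obj X).obj m} (he : IsReflection S e) (Z : C) :
    IsReflection S (inducedRefl S e Z) where
  natural {X Y} f := by
    rw [inducedRefl_hom, inducedRefl_hom, ← reassoc_of% hS.swap_natural_left, Category.assoc,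
      Category.assoc, hS.swap_natural_right, ← Functor.map_comp_assoc, he.natural,
      Functor.map_comp_assoc]
  refl_tensor X Y := by
    have h := congrArg (S.act.obj Z).map ((refl_tensor_iff e X Y).1 (he.refl_tensor X Y))
    simp only [Functor.map_comp] at h
    have hl : (S.assocIso X Y ((S.act.obj Z).obj m)).inv ≫ (S.swap (X ⊗ Y) Z m).hom
        = (S.act.obj X).map (S.swap Y Z m).hom ≫ (S.swap X Z ((S.act.obj Y).obj m)).hom
          ≫ (S.act.obj Z).map (S.assocIso X Y m).inv := by
      rw [Iso.inv_comp_eq, ← reassoc_of% hS.swap_tensor_left]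
      simp [← Functor.map_comp]
    rw [refl_tensor_iff]
    simp only [inducedRefl_hom, Functor.map_comp, Category.assoc]
    rw [reassoc_of% hl, hS.swap_tensor_right, reassoc_of% hS.swap_yang_baxter, reassoc_of% h,
      reassoc_of% hS.swap_natural_object, ← reassoc_of% (hS.swap_natural_object Z X (e Y).hom),
      reassoc_of% hS.swap_yang_baxter]

lemma isReflHom_act (hS : S.IsModule) {m n : M}
    {e : ∀ X : C, (S.act.obj X).obj m ≅ (S.act.obj X).obj m}
    {e' : ∀ X : C, (S.act.obj X).obj n ≅ (S.act.obj X).obj n}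
    {Y Y' : C} (g : Y ⟶ Y') {f : m ⟶ n} (hf : IsReflHom S e e' f) :
    IsReflHom S (inducedRefl S e Y) (inducedRefl S e' Y')
      ((S.act.map g).app m ≫ (S.act.obj Y').map f) := by
  intro X
  simp only [inducedRefl_hom, Functor.map_comp, Category.assoc]
  rw [reassoc_of% hS.swap_natural_left, hS.swap_natural_object, NatTrans.naturality_assoc,
    ← Functor.map_comp_assoc, hf X, Functor.map_comp_assoc, ← reassoc_of% hS.swap_natural_object,
    ← reassoc_of% hS.swap_natural_right]

lemma isReflHom_assocIso (hS : S.IsModule) {m : M}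
    (e : ∀ X : C, (S.act.obj X).obj m ≅ (S.act.obj X).obj m) (X Y : C) :
    IsReflHom S (inducedRefl S e (X ⊗ Y))
      (inducedRefl S (inducedRefl S e Y) X) ((S.assocIso X Y m).hom) := by
  intro W
  simp only [inducedRefl_hom, Functor.map_comp, Category.assoc]
  rw [hS.swap_tensor_left, ← reassoc_of% hS.swap_tensor_right, reassoc_of% hS.assoc_natural_right]

lemma isReflHom_unitIso (hS : S.IsModule) {m : M}
    (e : ∀ X : C, (S.act.obj X).obj m ≅ (S.act.obj X).obj m) :
    IsReflHom S (inducedRefl S e (𝟙_ C)) e ((S.unitIso m).hom) := by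
  intro X
  rw [inducedRefl_hom, Category.assoc, Category.assoc, hS.swap_unit_left, hS.unit_natural,
    ← Category.assoc, hS.swap_unit_right]

end

end Refl

open Refl

/-- Lemma 4.2.  Let `C` be a braided monoidal category and `M` a left
`C`-module category.  The reflective center `E_C(M)` is a left `C`-module category with
action `Y ▷ (m, e) := (Y ▷ m, e^{Y ▷ m})` (where `e^{Y▷m}` is given by formula (3.6))
and with the associativity and unit constraints of `M`.  Concretely:
(i) `(Y ▷ m, e^{Y▷m})` is again an object of `E_C(M)`;
(ii) the action is well defined on morphisms;
(iii) the associativity constraints of `M` are morphisms in `E_C(M)`;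
(iv) the unit constraints of `M` are morphisms in `E_C(M)`. -/
theorem reflective_center_module_category
    {C : Type u₁} [Category.{v₁} C] [MonoidalCategory C] [BraidedCategory C]
    {M : Type u₂} [Category.{v₂} M]
    (S : LeftModuleData C M) (hS : S.IsModule) :
    (∀ (m : M) (e : ∀ X : C, (S.act.obj X).obj m ≅ (S.act.obj X).obj m),
        IsReflection S e → ∀ Y : C, IsReflection S (inducedRefl S e Y))
    ∧ (∀ (m n : M)
        (e : ∀ X : C, (S.act.obj X).obj m ≅ (S.act.obj X).obj m)
        (e' : ∀ X : C, (S.act.obj X).obj n ≅ (S.act.obj X).obj n),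
        IsReflection S e → IsReflection S e' →
        ∀ {Y Y' : C} (g : Y ⟶ Y') (f : m ⟶ n), IsReflHom S e e' f →
          IsReflHom S (inducedRefl S e Y) (inducedRefl S e' Y')
            ((S.act.map g).app m ≫ (S.act.obj Y').map f))
    ∧ (∀ (m : M) (e : ∀ X : C, (S.act.obj X).obj m ≅ (S.act.obj X).obj m),
        IsReflection S e → ∀ X Y : C,
          IsReflHom S (inducedRefl S e (X ⊗ Y))
            (inducedRefl S (inducedRefl S e Y) X) ((S.assocIso X Y m).hom))
    ∧ (∀ (m : M) (e : ∀ X : C, (S.act.obj X).obj m ≅ (S.act.obj X).obj m),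
        IsReflection S e →
          IsReflHom S (inducedRefl S e (𝟙_ C)) e ((S.unitIso m).hom)) := by
  exact ⟨fun _ _ he Y ↦ isReflection_inducedRefl hS he Y,
    fun _ _ _ _ _ _ _ _ g _ hf ↦ isReflHom_act hS g hf,
    fun _ e _ ↦ isReflHom_assocIso hS e,
    fun _ e _ ↦ isReflHom_unitIso hS e⟩
end

section
/- Let (C, c) be a braided monoidal category and (M, ▷, m, λ) a left C-module category, and let M_bim be the C-bimodule category with M ◁ X := X ▷ M, n_{M,X,Y} := m_{Y,X,M} ∘ (c_{X,Y} ▷ Id_M), ρ := λ, and b_{X,M,Y} := m_{X,Y,M} ∘ (c_{X,Y}^{-1} ▷ Id_M) ∘ m_{Y,X,M}^{-1}. Then the reflective center E_C(M) and the center Z_C(M_bim) of the bimodule category M_bim are isomorphic as categories; explicitly, the assignment (M, e^M) ↦ (M, d^M := e^M) (identifying reflections with half-braidings d^M_X: X ▷ M ≅ M ◁ X = X ▷ M) and the identity on morphisms is an isomorphism of categories. -/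
open CategoryTheory MonoidalCategory

universe v₁ v₂ u₁ u₂

namespace Refl

variable (C : Type u₁) [Category.{v₁} C] [MonoidalCategory C]
variable (M : Type u₂) [Category.{v₂} M]

variable {C M}

section Bimodule

variable (C M)

/-- Data of a `C`-bimodule category: a left module structure, a right module structure
(with right action functor `ract`, so that `m ◁ X = (ract.obj X).obj m`), and a middle
associativity constraint `b_{X,m,Y} : (X ▷ m) ◁ Y ≅ X ▷ (m ◁ Y)`. -/
structure BimoduleData where
  left : LeftModuleData C M
  ract : C ⥤ M ⥤ M
  rassocIso : ∀ (m : M) (X Y : C),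
    (ract.obj (X ⊗ Y)).obj m ≅ (ract.obj Y).obj ((ract.obj X).obj m)
  runitIso : ∀ m : M, (ract.obj (𝟙_ C)).obj m ≅ m
  middle : ∀ (X : C) (m : M) (Y : C),
    (ract.obj Y).obj ((left.act.obj X).obj m) ≅ (left.act.obj X).obj ((ract.obj Y).obj m)

namespace BimoduleData

variable {C M}

/-- The axioms of a `C`-bimodule category. -/
structure IsBimodule (B : BimoduleData C M) : Prop where
  left_mod : B.left.IsModule
  rassoc_natural_fst : ∀ (m : M) {X X' : C} (f : X ⟶ X') (Y : C),
    (B.ract.map (f ▷ Y)).app m ≫ (B.rassocIso m X' Y).hom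
      = (B.rassocIso m X Y).hom ≫ (B.ract.obj Y).map ((B.ract.map f).app m)
  rassoc_natural_snd : ∀ (m : M) (X : C) {Y Y' : C} (g : Y ⟶ Y'),
    (B.ract.map (X ◁ g)).app m ≫ (B.rassocIso m X Y').hom
      = (B.rassocIso m X Y).hom ≫ (B.ract.map g).app ((B.ract.obj X).obj m)
  rassoc_natural_pt : ∀ {m m' : M} (h : m ⟶ m') (X Y : C),
    (B.ract.obj (X ⊗ Y)).map h ≫ (B.rassocIso m' X Y).hom
      = (B.rassocIso m X Y).hom ≫ (B.ract.obj Y).map ((B.ract.obj X).map h)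
  runit_natural : ∀ {m m' : M} (h : m ⟶ m'),
    (B.ract.obj (𝟙_ C)).map h ≫ (B.runitIso m').hom = (B.runitIso m).hom ≫ h
  rpentagon : ∀ (m : M) (X Y Z : C),
    (B.rassocIso m X (Y ⊗ Z)).hom ≫ (B.rassocIso ((B.ract.obj X).obj m) Y Z).hom
      = (B.ract.map (α_ X Y Z).inv).app m ≫ (B.rassocIso m (X ⊗ Y) Z).hom
          ≫ (B.ract.obj Z).map ((B.rassocIso m X Y).hom)
  rtriangle : ∀ (m : M) (X : C),
    (B.ract.map (λ_ X).hom).app m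
      = (B.rassocIso m (𝟙_ C) X).hom ≫ (B.ract.obj X).map ((B.runitIso m).hom)
  middle_natural_left : ∀ {X X' : C} (f : X ⟶ X') (m : M) (Y : C),
    (B.ract.obj Y).map ((B.left.act.map f).app m) ≫ (B.middle X' m Y).hom
      = (B.middle X m Y).hom ≫ (B.left.act.map f).app ((B.ract.obj Y).obj m)
  middle_natural_mid : ∀ (X : C) {m m' : M} (g : m ⟶ m') (Y : C),
    (B.ract.obj Y).map ((B.left.act.obj X).map g) ≫ (B.middle X m' Y).hom
      = (B.middle X m Y).hom ≫ (B.left.act.obj X).map ((B.ract.obj Y).map g)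
  middle_natural_right : ∀ (X : C) (m : M) {Y Y' : C} (h : Y ⟶ Y'),
    (B.ract.map h).app ((B.left.act.obj X).obj m) ≫ (B.middle X m Y').hom
      = (B.middle X m Y).hom ≫ (B.left.act.obj X).map ((B.ract.map h).app m)
  middle_left_pentagon : ∀ (X Y : C) (m : M) (Z : C),
    (B.ract.obj Z).map ((B.left.assocIso X Y m).hom)
        ≫ (B.middle X ((B.left.act.obj Y).obj m) Z).hom
        ≫ (B.left.act.obj X).map ((B.middle Y m Z).hom)
      = (B.middle (X ⊗ Y) m Z).hom ≫ (B.left.assocIso X Y ((B.ract.obj Z).obj m)).hom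
  middle_right_pentagon : ∀ (X : C) (m : M) (Y Z : C),
    (B.rassocIso ((B.left.act.obj X).obj m) Y Z).hom
        ≫ (B.ract.obj Z).map ((B.middle X m Y).hom)
        ≫ (B.middle X ((B.ract.obj Y).obj m) Z).hom
      = (B.middle X m (Y ⊗ Z)).hom ≫ (B.left.act.obj X).map ((B.rassocIso m Y Z).hom)
  middle_unit_left : ∀ (m : M) (Y : C),
    (B.middle (𝟙_ C) m Y).hom ≫ (B.left.unitIso ((B.ract.obj Y).obj m)).hom
      = (B.ract.obj Y).map ((B.left.unitIso m).hom)
  middle_unit_right : ∀ (X : C) (m : M),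
    (B.middle X m (𝟙_ C)).hom ≫ (B.left.act.obj X).map ((B.runitIso m).hom)
      = (B.runitIso ((B.left.act.obj X).obj m)).hom

end BimoduleData

variable {C M}

/-- The one-sided `C`-bimodule category `M_bim` attached to a left module category `M`
over a braided category `C`:  `m ◁ X := X ▷ m`,
`n_{m,X,Y} := m_{Y,X,m} ∘ (c_{X,Y} ▷ Id)`, `ρ := λ`, and
`b_{X,m,Y} := m_{X,Y,m} ∘ (c⁻¹_{X,Y} ▷ Id) ∘ m⁻¹_{Y,X,m}`. -/
def bimData [BraidedCategory C] (S : LeftModuleData C M) : BimoduleData C M where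
  left := S
  ract := S.act
  rassocIso m X Y := (S.act.mapIso (β_ X Y)).app m ≪≫ S.assocIso Y X m
  runitIso := S.unitIso
  middle X m Y :=
    (S.assocIso Y X m).symm ≪≫ (S.act.mapIso (β_ X Y).symm).app m ≪≫ S.assocIso X Y m

end Bimodule

section Center

/-- A half-braiding on an object `m` of a `C`-bimodule category, i.e. an object
`(m, d)` of the center `Z_C(M)` of the bimodule category:  a natural family
`d_X : X ▷ m ≅ m ◁ X` satisfying
`d_{X⊗Y} = n⁻¹ ∘ (d_X ◁ Id_Y) ∘ b⁻¹ ∘ (Id_X ▷ d_Y) ∘ m_{X,Y,m}`. -/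
structure IsCenterObj (B : BimoduleData C M) {m : M}
    (d : ∀ X : C, (B.left.act.obj X).obj m ≅ (B.ract.obj X).obj m) : Prop where
  natural : ∀ {X Y : C} (f : X ⟶ Y),
    (B.left.act.map f).app m ≫ (d Y).hom = (d X).hom ≫ (B.ract.map f).app m
  center_tensor : ∀ X Y : C,
    (d (X ⊗ Y)).hom
      = (B.left.assocIso X Y m).hom
          ≫ (B.left.act.obj X).map ((d Y).hom)
          ≫ (B.middle X m Y).inv
          ≫ (B.ract.obj Y).map ((d X).hom)
          ≫ (B.rassocIso m X Y).inv

/-- The condition for `f : m ⟶ n` to define a morphism `(m, d) ⟶ (n, d')` in the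
center of a bimodule category. -/
def IsCenterHom (B : BimoduleData C M) {m n : M}
    (d : ∀ X : C, (B.left.act.obj X).obj m ≅ (B.ract.obj X).obj m)
    (d' : ∀ X : C, (B.left.act.obj X).obj n ≅ (B.ract.obj X).obj n)
    (f : m ⟶ n) : Prop :=
  ∀ X : C, (d X).hom ≫ (B.ract.obj X).map f = (B.left.act.obj X).map f ≫ (d' X).hom

end Center

end Refl

open Refl

/-- Proposition 4.8.  For a braided monoidal category `C` and a left
`C`-module category `M`, the reflective center `E_C(M)` is isomorphic, as a category,
to the center `Z_C(M_bim)` of the one-sided bimodule category `M_bim`:  a family `e` of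
isomorphisms `X ▷ m ≅ X ▷ m` is a reflection on `m` if and only if it is a
half-braiding for `M_bim` (objects correspond via `(m, e) ↦ (m, d := e)`), and a
morphism of `M` is a morphism in `E_C(M)` if and only if it is a morphism in
`Z_C(M_bim)`. -/
theorem reflective_center_iso_center_of_bimodule
    {C : Type u₁} [Category.{v₁} C] [MonoidalCategory C] [BraidedCategory C]
    {M : Type u₂} [Category.{v₂} M]
    (S : LeftModuleData C M) (hS : S.IsModule) :
    (∀ (m : M) (e : ∀ X : C, (S.act.obj X).obj m ≅ (S.act.obj X).obj m),
        IsReflection S e ↔ IsCenterObj (bimData S) e)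
    ∧ (∀ (m n : M)
        (e : ∀ X : C, (S.act.obj X).obj m ≅ (S.act.obj X).obj m)
        (e' : ∀ X : C, (S.act.obj X).obj n ≅ (S.act.obj X).obj n)
        (f : m ⟶ n),
        IsReflHom S e e' f ↔ IsCenterHom (bimData S) e e' f) := by
  refine ⟨fun m e => ⟨fun h => ⟨h.natural, fun X Y => ?_⟩, fun h => ⟨h.natural, fun X Y => ?_⟩⟩,
    fun m n e e' f => Iff.rfl⟩
  -- Naturality along the braiding exchanges the two tensor axioms, with `X` and `Y` swapped.
  · have nat := h.natural (β_ X Y).hom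
    rw [h.refl_tensor Y X] at nat
    have key := congrArg (· ≫ (S.act.map (β_ X Y).inv).app m) nat
    simpa [bimData, ← NatTrans.comp_app_assoc, ← NatTrans.comp_app, ← Functor.map_comp]
      using key.symm
  · have nat := h.natural (β_ Y X).hom
    rw [h.center_tensor Y X] at nat
    have key := congrArg ((S.act.map (β_ Y X).inv).app m ≫ ·) nat
    simpa [bimData, ← NatTrans.comp_app_assoc, ← NatTrans.comp_app, ← Functor.map_comp]
      using key
end
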